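/- Suppose Φ : [0,∞) → ℝ is convex and admits the representation Φ(u) = βu² − ∫_{(0,1)} λu/(λu + 1 − λ) Υ(dλ) + au + b for all u ≥ 0, where β ≥ 0, a, b ∈ ℝ, and Υ is a finite positive Borel measure on (0,1). (By Loewner's theorem, every operator convex Φ : [0,∞) → ℝ with Φ(0) = 0 is of this form.) Then for every admissible pair (μ,K) on finite alphabets: η_Φ(μ,K) ≤ max( S(μ,K)², sup_{0<λ<1} η_{LC_λ}(μ,K) ). If moreover β > 0 or Υ((0,1)) > 0, then also η_Φ(μ,K) ≥ S(μ,K)². -/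

import Mathlib

open Finset

noncomputable section

namespace SDPI

variable {X Y : Type} [Fintype X] [Fintype Y]

def IsDist (μ : X → ℝ) : Prop := (∀ x, 0 ≤ μ x) ∧ ∑ x, μ x = 1

def IsPosDist (μ : X → ℝ) : Prop := (∀ x, 0 < μ x) ∧ ∑ x, μ x = 1

def IsChannel (K : X → Y → ℝ) : Prop :=
  (∀ x y, 0 ≤ K x y) ∧ ∀ x, ∑ y, K x y = 1

def push (μ : X → ℝ) (K : X → Y → ℝ) : Y → ℝ := fun y => ∑ x, μ x * K x y

def fDiv (Φ : ℝ → ℝ) (ν μ : X → ℝ) : ℝ := (∑ x, μ x * Φ (ν x / μ x)) - Φ 1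

def eta (Φ : ℝ → ℝ) (μ : X → ℝ) (K : X → Y → ℝ) : ℝ :=
  sSup { r | ∃ ν : X → ℝ, IsDist ν ∧ ν ≠ μ ∧
    r = fDiv Φ (push ν K) (push μ K) / fDiv Φ ν μ }

def etaSup (Φ : ℝ → ℝ) (K : X → Y → ℝ) : ℝ :=
  sSup { r | ∃ μ : X → ℝ, IsPosDist μ ∧ r = eta Φ μ K }

def maxCorr (μ : X → ℝ) (K : X → Y → ℝ) : ℝ :=
  sSup { r | ∃ (f : X → ℝ) (g : Y → ℝ),
    (∑ x, μ x * f x) = 0 ∧ (∑ y, push μ K y * g y) = 0 ∧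
    (∑ x, μ x * (f x) ^ 2) = 1 ∧ (∑ y, push μ K y * (g y) ^ 2) = 1 ∧
    r = ∑ x, ∑ y, μ x * K x y * (f x * g y) }

def adjoint (μ : X → ℝ) (K : X → Y → ℝ) : Y → X → ℝ :=
  fun y x => K x y * μ x / push μ K y

def Ent (Φ : ℝ → ℝ) (μ : X → ℝ) (f : X → ℝ) : ℝ :=
  (∑ x, μ x * Φ (f x)) - Φ (∑ x, μ x * f x)

def Var (μ : X → ℝ) (f : X → ℝ) : ℝ :=
  ∑ x, μ x * (f x - ∑ x', μ x' * f x') ^ 2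

def condExp (μ : X → ℝ) (K : X → Y → ℝ) (f : X → ℝ) : Y → ℝ :=
  fun y => (∑ x, μ x * K x y * f x) / push μ K y

def calE (μ : X → ℝ) (K : X → Y → ℝ) (f g : X → ℝ) : ℝ :=
  ∑ x, ∑ y, μ x * K x y *
    ((f x - condExp μ K f y) * (g x - condExp μ K g y))

def dirichlet (μ : X → ℝ) (M : X → X → ℝ) (f g : X → ℝ) : ℝ :=
  (1 / 2) * ∑ x, ∑ x', μ x * M x x' * ((f x - f x') * (g x - g x'))

def Homogeneous (Φ : ℝ → ℝ) : Prop :=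
  ∃ κ : ℝ → ℝ, (∀ c : ℝ, 0 < c → 0 < κ c) ∧
    ∀ (c : ℝ), 0 < c → ∀ (Z : Type) [Fintype Z], ∀ (μ : Z → ℝ),
      IsDist μ → ∀ f : Z → ℝ, (∀ z, 0 ≤ f z) →
        Ent Φ μ (fun z => c * f z) = κ c * Ent Φ μ f

def Subadditive (Φ : ℝ → ℝ) : Prop :=
  ∀ (n : ℕ) (Z : Fin n → Type) [∀ i, Fintype (Z i)],
    ∀ (μ : ∀ i, Z i → ℝ), (∀ i, IsDist (μ i)) →
    ∀ f : (∀ i, Z i) → ℝ, (∀ z, 0 ≤ f z) →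
      Ent Φ (fun z : ∀ i, Z i => ∏ i, μ i (z i)) f ≤
        ∑ i : Fin n,
          ((∑ z : ∀ j, Z j, (∏ j, μ j (z j)) * Φ (f z)) -
            ∑ z : ∀ j, Z j, (∏ j, μ j (z j)) *
              Φ (∑ w : Z i, μ i w * f (Function.update z i w)))


/-- The generator of the Le Cam divergence with parameter `l`. -/
def leCam (l : ℝ) : ℝ → ℝ := fun u => l * (1 - l) * (u - 1) ^ 2 / (l * u + 1 - l)

/-- The chi-square divergence. -/
def chiSq (ν μ : X → ℝ) : ℝ := ∑ x, μ x * (ν x / μ x - 1) ^ 2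

lemma leCam_denom_pos {l u : ℝ} (hl : l ∈ Set.Ioo (0 : ℝ) 1) (hu : 0 ≤ u) :
    0 < l * u + 1 - l := by
  have := mul_nonneg hl.1.le hu
  linarith [hl.2]

lemma push_isDist {μ : X → ℝ} {K : X → Y → ℝ} (hμ : IsDist μ) (hK : IsChannel K) :
    IsDist (push μ K) := by
  refine ⟨fun y => sum_nonneg fun x _ => mul_nonneg (hμ.1 x) (hK.1 x y), ?_⟩
  simp only [push]
  rw [sum_comm]
  simp [← mul_sum, hK.2, hμ.2]

lemma IsPosDist.isDist {μ : X → ℝ} (hμ : IsPosDist μ) : IsDist μ :=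
  ⟨fun x => (hμ.1 x).le, hμ.2⟩

lemma fDiv_leCam (l : ℝ) (ν μ : X → ℝ) :
    fDiv (leCam l) ν μ = ∑ x, μ x * leCam l (ν x / μ x) := by
  simp [fDiv, leCam]

lemma leCam_nonneg {l u : ℝ} (hl : l ∈ Set.Ioo (0 : ℝ) 1) (hu : 0 ≤ u) : 0 ≤ leCam l u :=
  div_nonneg (mul_nonneg (mul_nonneg hl.1.le (by linarith [hl.2])) (sq_nonneg _))
    (leCam_denom_pos hl hu).le

lemma fDiv_leCam_nonneg {l : ℝ} (hl : l ∈ Set.Ioo (0 : ℝ) 1) {ν μ : X → ℝ} (hν : IsDist ν)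
    (hμ : IsPosDist μ) : 0 ≤ fDiv (leCam l) ν μ := by
  rw [fDiv_leCam]
  exact sum_nonneg fun x _ => mul_nonneg (hμ.1 x).le
    (leCam_nonneg hl (div_nonneg (hν.1 x) (hμ.1 x).le))

lemma chiSq_nonneg {ν μ : X → ℝ} (hμ : IsPosDist μ) : 0 ≤ chiSq ν μ :=
  sum_nonneg fun x _ => mul_nonneg (hμ.1 x).le (sq_nonneg _)

lemma mul_leCam_div {l m n : ℝ} (hm : 0 < m) :
    m * leCam l (n / m) = l * (1 - l) * ((n - m) ^ 2 / (l * n + (1 - l) * m)) := by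
  have h : l * (n / m) + 1 - l = (l * n + (1 - l) * m) / m := by field_simp; ring
  have h' : n / m - 1 = (n - m) / m := by field_simp
  rw [leCam, h, h']
  field_simp

lemma sq_sum_div_le {ν μ k : X → ℝ} (hk : ∀ x, 0 ≤ k x) {l : ℝ} (hl : l ∈ Set.Ioo (0 : ℝ) 1)
    (hν : ∀ x, 0 ≤ ν x) (hμ : ∀ x, 0 < μ x) :
    (∑ x, ν x * k x - ∑ x, μ x * k x) ^ 2 /
        (l * ∑ x, ν x * k x + (1 - l) * ∑ x, μ x * k x) ≤
      ∑ x, k x * ((ν x - μ x) ^ 2 / (l * ν x + (1 - l) * μ x)) := by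
  have hw : ∀ x, 0 < l * ν x + (1 - l) * μ x := fun x =>
    add_pos_of_nonneg_of_pos (mul_nonneg hl.1.le (hν x))
      (mul_pos (by linarith [hl.2]) (hμ x))
  have hf : ∀ x, 0 ≤ k x * ((ν x - μ x) ^ 2 / (l * ν x + (1 - l) * μ x)) := fun x =>
    mul_nonneg (hk x) (div_nonneg (sq_nonneg _) (hw x).le)
  have hg : ∀ x, 0 ≤ k x * (l * ν x + (1 - l) * μ x) := fun x => mul_nonneg (hk x) (hw x).le
  have key := sum_sq_le_sum_mul_sum_of_sq_le_mul univ (r := fun x => k x * (ν x - μ x))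
    (fun x _ => hf x) (fun x _ => hg x) (fun x _ => le_of_eq <| by
      rw [mul_mul_mul_comm, div_mul_cancel₀ _ (hw x).ne', mul_pow, sq (k x)])
  have h1 : ∑ x, ν x * k x - ∑ x, μ x * k x = ∑ x, k x * (ν x - μ x) := by
    rw [← sum_sub_distrib]; exact sum_congr rfl fun x _ => by ring
  have h2 : l * ∑ x, ν x * k x + (1 - l) * ∑ x, μ x * k x
      = ∑ x, k x * (l * ν x + (1 - l) * μ x) := by
    rw [mul_sum, mul_sum, ← sum_add_distrib]; exact sum_congr rfl fun x _ => by ring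
  rw [h1, h2]
  exact div_le_of_le_mul₀ (sum_nonneg fun x _ => hg x) (sum_nonneg fun x _ => hf x) key

/-- Data processing inequality for the Le Cam divergence. -/
lemma fDiv_leCam_push_le {l : ℝ} (hl : l ∈ Set.Ioo (0 : ℝ) 1) {ν μ : X → ℝ} {K : X → Y → ℝ}
    (hν : IsDist ν) (hμ : IsPosDist μ) (hK : IsChannel K) (hadm : ∀ y, 0 < push μ K y) :
    fDiv (leCam l) (push ν K) (push μ K) ≤ fDiv (leCam l) ν μ := by
  simp only [fDiv_leCam, mul_leCam_div (hadm _), mul_leCam_div (hμ.1 _), ← mul_sum]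
  refine mul_le_mul_of_nonneg_left ?_ (mul_nonneg hl.1.le (by linarith [hl.2]))
  refine (sum_le_sum fun y _ => sq_sum_div_le (fun x => hK.1 x y) hl hν.1 hμ.1).trans_eq ?_
  rw [sum_comm]
  simp [← sum_mul, hK.2]

lemma eta_leCam_ratio_le_one {l : ℝ} (hl : l ∈ Set.Ioo (0 : ℝ) 1) {ν μ : X → ℝ}
    {K : X → Y → ℝ} (hν : IsDist ν) (hμ : IsPosDist μ) (hK : IsChannel K)
    (hadm : ∀ y, 0 < push μ K y) :
    fDiv (leCam l) (push ν K) (push μ K) / fDiv (leCam l) ν μ ≤ 1 :=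
  div_le_one_of_le₀ (fDiv_leCam_push_le hl hν hμ hK hadm) (fDiv_leCam_nonneg hl hν hμ)

lemma eta_leCam_le_one {l : ℝ} (hl : l ∈ Set.Ioo (0 : ℝ) 1) {μ : X → ℝ} {K : X → Y → ℝ}
    (hμ : IsPosDist μ) (hK : IsChannel K) (hadm : ∀ y, 0 < push μ K y) :
    eta (leCam l) μ K ≤ 1 := by
  refine Real.sSup_le ?_ zero_le_one
  rintro r ⟨ν, hν, -, rfl⟩
  exact eta_leCam_ratio_le_one hl hν hμ hK hadm

lemma fDiv_self (Φ : ℝ → ℝ) {μ : X → ℝ} (hμ : IsPosDist μ) : fDiv Φ μ μ = 0 := by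
  simp [fDiv, div_self (hμ.1 _).ne', ← sum_mul, hμ.2]

lemma fDiv_leCam_push_le_eta_mul {l : ℝ} (hl : l ∈ Set.Ioo (0 : ℝ) 1) {ν μ : X → ℝ}
    {K : X → Y → ℝ} (hν : IsDist ν) (hμ : IsPosDist μ) (hK : IsChannel K)
    (hadm : ∀ y, 0 < push μ K y) :
    fDiv (leCam l) (push ν K) (push μ K) ≤ eta (leCam l) μ K * fDiv (leCam l) ν μ := by
  have hle := fDiv_leCam_push_le hl hν hμ hK hadm
  rcases (fDiv_leCam_nonneg hl hν hμ).eq_or_lt with h0 | hpos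
  · rw [← h0] at hle ⊢
    simpa using hle
  rw [← div_le_iff₀ hpos]
  refine le_csSup ⟨1, ?_⟩ ⟨ν, hν, ?_, rfl⟩
  · rintro r ⟨ν', hν', -, rfl⟩
    exact eta_leCam_ratio_le_one hl hν' hμ hK hadm
  · rintro rfl
    rw [fDiv_self _ hμ] at hpos
    exact hpos.false

lemma integrableOn_kernel (Υ : MeasureTheory.Measure ℝ) [MeasureTheory.IsFiniteMeasure Υ]
    {u : ℝ} (hu : 0 ≤ u) :
    MeasureTheory.IntegrableOn (fun l => l * u / (l * u + 1 - l)) (Set.Ioo (0 : ℝ) 1) Υ := by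
  refine MeasureTheory.Measure.integrableOn_of_bounded (M := 1)
    (MeasureTheory.measure_ne_top _ _)
    (by fun_prop : Measurable fun l : ℝ => l * u / (l * u + 1 - l)).aestronglyMeasurable ?_
  filter_upwards [MeasureTheory.ae_restrict_mem measurableSet_Ioo] with l hl
  have h := leCam_denom_pos hl hu
  rw [Real.norm_of_nonneg (div_nonneg (mul_nonneg hl.1.le hu) h.le), div_le_one h]
  linarith [hl.2]

lemma integrableOn_id_Ioo (Υ : MeasureTheory.Measure ℝ) [MeasureTheory.IsFiniteMeasure Υ] :
    MeasureTheory.IntegrableOn (fun l : ℝ => l) (Set.Ioo (0 : ℝ) 1) Υ :=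
  (integrableOn_kernel Υ zero_le_one).congr_fun (fun l _ => by simp) measurableSet_Ioo

lemma mul_leCam_eq {l u : ℝ} (hl : l ∈ Set.Ioo (0 : ℝ) 1) (hu : 0 ≤ u) :
    l * leCam l u = (1 - l) * (l * (u - 1) - 1) + 1 - l * u / (l * u + 1 - l) := by
  have h := (leCam_denom_pos hl hu).ne'
  rw [leCam]
  field_simp
  ring

lemma sum_mul_ratio {ν μ : X → ℝ} (hμ : IsPosDist μ) : ∑ x, μ x * (ν x / μ x) = ∑ x, ν x :=
  sum_congr rfl fun x _ => mul_div_cancel₀ _ (hμ.1 x).ne'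

lemma mul_fDiv_leCam {l : ℝ} (hl : l ∈ Set.Ioo (0 : ℝ) 1) {ν μ : X → ℝ} (hν : IsDist ν)
    (hμ : IsPosDist μ) :
    l * fDiv (leCam l) ν μ =
      l - ∑ x, μ x * (l * (ν x / μ x) / (l * (ν x / μ x) + 1 - l)) := by
  have h : ∀ x, l * (μ x * leCam l (ν x / μ x)) =
      (1 - l) * l * (μ x * (ν x / μ x)) + (l - (1 - l) * l) * μ x
        - μ x * (l * (ν x / μ x) / (l * (ν x / μ x) + 1 - l)) := fun x => by
    rw [mul_left_comm, mul_leCam_eq hl (div_nonneg (hν.1 x) (hμ.1 x).le)]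
    ring
  rw [fDiv_leCam, mul_sum, sum_congr rfl fun x _ => h x, sum_sub_distrib, sum_add_distrib,
    ← mul_sum, ← mul_sum, sum_mul_ratio hμ, hν.2, hμ.2]
  ring

lemma integrableOn_mul_fDiv_leCam (Υ : MeasureTheory.Measure ℝ)
    [MeasureTheory.IsFiniteMeasure Υ] {ν μ : X → ℝ} (hν : IsDist ν) (hμ : IsPosDist μ) :
    MeasureTheory.IntegrableOn (fun l => l * fDiv (leCam l) ν μ) (Set.Ioo (0 : ℝ) 1) Υ := by
  refine MeasureTheory.IntegrableOn.congr_fun ?_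
    (fun l hl => (mul_fDiv_leCam hl hν hμ).symm) measurableSet_Ioo
  exact (integrableOn_id_Ioo Υ).sub (MeasureTheory.integrable_finsetSum _ fun x _ =>
    (integrableOn_kernel Υ (div_nonneg (hν.1 x) (hμ.1 x).le)).const_mul _)

lemma chiSq_eq {ν μ : X → ℝ} (hν : IsDist ν) (hμ : IsPosDist μ) :
    chiSq ν μ = ∑ x, μ x * (ν x / μ x) ^ 2 - 1 := by
  have h : ∀ x, μ x * (ν x / μ x - 1) ^ 2 =
      μ x * (ν x / μ x) ^ 2 - 2 * (μ x * (ν x / μ x)) + μ x := fun x => by ring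
  rw [chiSq, sum_congr rfl fun x _ => h x, sum_add_distrib, sum_sub_distrib, ← mul_sum,
    sum_mul_ratio hμ, hν.2, hμ.2]
  ring

/-- A divergence with a Loewner-type generator is a mixture of the chi-square divergence and
of Le Cam divergences. -/
lemma fDiv_eq_mixture {Φ : ℝ → ℝ} {β a b : ℝ} (Υ : MeasureTheory.Measure ℝ)
    [MeasureTheory.IsFiniteMeasure Υ]
    (hrep : ∀ u : ℝ, 0 ≤ u →
      Φ u = β * u ^ 2 - (∫ l in Set.Ioo (0 : ℝ) 1, l * u / (l * u + 1 - l) ∂Υ) + a * u + b)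
    {ν μ : X → ℝ} (hν : IsDist ν) (hμ : IsPosDist μ) :
    fDiv Φ ν μ =
      β * chiSq ν μ + ∫ l in Set.Ioo (0 : ℝ) 1, l * fDiv (leCam l) ν μ ∂Υ := by
  have hu : ∀ x, 0 ≤ ν x / μ x := fun x => div_nonneg (hν.1 x) (hμ.1 x).le
  have hint := fun x => (integrableOn_kernel Υ (hu x)).const_mul (μ x)
  rw [MeasureTheory.setIntegral_congr_fun measurableSet_Ioo
      (fun l hl => mul_fDiv_leCam hl hν hμ),
    MeasureTheory.integral_sub (integrableOn_id_Ioo Υ)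
      (MeasureTheory.integrable_finsetSum _ fun x _ => hint x),
    MeasureTheory.integral_finsetSum _ fun x _ => hint x, chiSq_eq hν hμ]
  simp only [MeasureTheory.integral_const_mul]
  have h : ∀ x, μ x * Φ (ν x / μ x) = β * (μ x * (ν x / μ x) ^ 2)
      - μ x * (∫ l in Set.Ioo (0 : ℝ) 1,
          l * (ν x / μ x) / (l * (ν x / μ x) + 1 - l) ∂Υ)
      + a * (μ x * (ν x / μ x)) + b * μ x := fun x => by
    rw [hrep _ (hu x)]; ring
  rw [fDiv, sum_congr rfl fun x _ => h x, sum_add_distrib, sum_add_distrib, sum_sub_distrib,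
    ← mul_sum, ← mul_sum, ← mul_sum, sum_mul_ratio hμ, hν.2, hμ.2, hrep 1 zero_le_one]
  simp
  ring

lemma push_div_sub_one {Y : Type} {ν μ : X → ℝ} {K : X → Y → ℝ} (hμ : IsPosDist μ)
    (hadm : ∀ y, 0 < push μ K y) (y : Y) :
    push ν K y / push μ K y - 1 = condExp μ K (fun x => ν x / μ x - 1) y := by
  rw [condExp, div_sub_one (hadm y).ne']
  congr 1
  simp only [push]
  rw [← sum_sub_distrib]
  refine sum_congr rfl fun x _ => ?_
  have := (hμ.1 x).ne'
  field_simp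

lemma joint_sum_eq {μ : X → ℝ} {K : X → Y → ℝ} (hadm : ∀ y, 0 < push μ K y) (f : X → ℝ)
    (g : Y → ℝ) :
    ∑ x, ∑ y, μ x * K x y * (f x * g y) = ∑ y, push μ K y * (condExp μ K f y * g y) := by
  rw [sum_comm]
  refine sum_congr rfl fun y _ => ?_
  rw [condExp, ← mul_assoc, mul_div_cancel₀ _ (hadm y).ne', sum_mul]
  exact sum_congr rfl fun x _ => by ring

lemma joint_sum_le_one {μ : X → ℝ} {K : X → Y → ℝ} (hμ : IsPosDist μ) (hK : IsChannel K)
    {f : X → ℝ} {g : Y → ℝ} (hf : ∑ x, μ x * f x ^ 2 = 1)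
    (hg : ∑ y, push μ K y * g y ^ 2 = 1) :
    ∑ x, ∑ y, μ x * K x y * (f x * g y) ≤ 1 := by
  have h1 : ∑ x, ∑ y, μ x * K x y * f x ^ 2 = 1 := by
    rw [← hf]
    refine sum_congr rfl fun x _ => ?_
    rw [← sum_mul, ← mul_sum, hK.2, mul_one]
  have h2 : ∑ x, ∑ y, μ x * K x y * g y ^ 2 = 1 := by
    rw [← hg, sum_comm]
    exact sum_congr rfl fun y _ => by rw [push, sum_mul]
  have h3 : ∑ x, ∑ y, μ x * K x y * (f x * g y) ≤
      ∑ x, ∑ y, (μ x * K x y * f x ^ 2 + μ x * K x y * g y ^ 2) / 2 :=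
    sum_le_sum fun x _ => sum_le_sum fun y _ => by
      nlinarith [mul_nonneg (mul_nonneg (hμ.1 x).le (hK.1 x y)) (sq_nonneg (f x - g y))]
  simp only [← sum_div, sum_add_distrib, h1, h2] at h3
  linarith

lemma sum_push_mul_condExp {μ : X → ℝ} {K : X → Y → ℝ} (hK : IsChannel K)
    (hadm : ∀ y, 0 < push μ K y) (f : X → ℝ) :
    ∑ y, push μ K y * condExp μ K f y = ∑ x, μ x * f x := by
  have := joint_sum_eq hadm f (fun _ => 1)
  simp only [mul_one] at this
  rw [← this]
  refine sum_congr rfl fun x _ => ?_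
  rw [← sum_mul, ← mul_sum, hK.2, mul_one]

/-- The square of the maximal correlation contracts second moments of centred functions. -/
lemma sum_condExp_sq_le {μ : X → ℝ} {K : X → Y → ℝ} (hμ : IsPosDist μ) (hK : IsChannel K)
    (hadm : ∀ y, 0 < push μ K y) {f : X → ℝ} (hf : ∑ x, μ x * f x = 0) :
    ∑ y, push μ K y * condExp μ K f y ^ 2 ≤ maxCorr μ K ^ 2 * ∑ x, μ x * f x ^ 2 := by
  set V := ∑ x, μ x * f x ^ 2 with hV
  set W := ∑ y, push μ K y * condExp μ K f y ^ 2 with hW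
  have hV0 : 0 ≤ V := sum_nonneg fun x _ => mul_nonneg (hμ.1 x).le (sq_nonneg _)
  have hW0 : 0 ≤ W := sum_nonneg fun y _ => mul_nonneg (hadm y).le (sq_nonneg _)
  rcases hW0.eq_or_lt with hW0' | hWpos
  · rw [← hW0']; positivity
  have hVpos : 0 < V := by
    refine hV0.lt_of_ne fun h => hWpos.ne' ?_
    have hz : ∀ x, f x = 0 := fun x => by
      have := (sum_eq_zero_iff_of_nonneg fun x _ =>
        mul_nonneg (hμ.1 x).le (sq_nonneg (f x))).1 h.symm x (mem_univ x)
      simpa [(hμ.1 x).ne'] using this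
    simp [hW, condExp, hz]
  have hsV : √V ^ 2 = V := Real.sq_sqrt hV0
  have hsW : √W ^ 2 = W := Real.sq_sqrt hW0
  have hpV := Real.sqrt_pos.2 hVpos
  have hpW := Real.sqrt_pos.2 hWpos
  have hmem : √W / √V ≤ maxCorr μ K := by
    refine le_csSup ⟨1, ?_⟩
      ⟨fun x => f x / √V, fun y => condExp μ K f y / √W, ?_, ?_, ?_, ?_, ?_⟩
    · rintro r ⟨f', g', -, -, h1, h2, rfl⟩
      exact joint_sum_le_one hμ hK h1 h2
    · simp [← mul_div_assoc, ← sum_div, hf]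
    · simp [← mul_div_assoc, ← sum_div, sum_push_mul_condExp hK hadm, hf]
    · simp only [div_pow, hsV, ← mul_div_assoc, ← sum_div]
      exact div_self hVpos.ne'
    · simp only [div_pow, hsW, ← mul_div_assoc, ← sum_div]
      exact div_self hWpos.ne'
    · have : ∀ x y, μ x * K x y * (f x / √V * (condExp μ K f y / √W)) =
          μ x * K x y * (f x * condExp μ K f y) / (√V * √W) := fun x y => by
        field_simp
      simp only [this, ← sum_div]
      rw [joint_sum_eq hadm]
      simp only [← sq]
      rw [← hW, div_eq_div_iff hpV.ne' (mul_pos hpV hpW).ne']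
      linear_combination √V * hsW
  have := pow_le_pow_left₀ (div_nonneg hpW.le hpV.le) hmem 2
  rwa [div_pow, hsV, hsW, div_le_iff₀ hVpos] at this

lemma chiSq_push_le {ν μ : X → ℝ} {K : X → Y → ℝ} (hν : IsDist ν) (hμ : IsPosDist μ)
    (hK : IsChannel K) (hadm : ∀ y, 0 < push μ K y) :
    chiSq (push ν K) (push μ K) ≤ maxCorr μ K ^ 2 * chiSq ν μ := by
  simp only [chiSq, push_div_sub_one hμ hadm]
  refine sum_condExp_sq_le hμ hK hadm ?_
  simp only [mul_sub, mul_one, sum_sub_distrib, sum_mul_ratio hμ, hν.2, hμ.2, sub_self]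

/-- Comparison of the Le Cam and chi-square divergences when the density is close to `1`. -/
lemma fDiv_leCam_bounds {l δ : ℝ} (hl : l ∈ Set.Ioo (0 : ℝ) 1) (hδ : δ ∈ Set.Ioo (0 : ℝ) 1)
    {ν μ : X → ℝ} (hμ : IsPosDist μ) (hνμ : ∀ x, |ν x / μ x - 1| ≤ δ) :
    l * (1 - l) / (1 + δ) * chiSq ν μ ≤ fDiv (leCam l) ν μ ∧
      fDiv (leCam l) ν μ ≤ l * (1 - l) / (1 - δ) * chiSq ν μ := by
  have h1l : 0 < 1 - l := by linarith [hl.2]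
  have h1δ : 0 < 1 - δ := by linarith [hδ.2]
  have hb : ∀ x, 1 - δ ≤ l * (ν x / μ x) + 1 - l ∧ l * (ν x / μ x) + 1 - l ≤ 1 + δ := by
    intro x
    obtain ⟨h1, h2⟩ := abs_le.1 (hνμ x)
    constructor <;> nlinarith [hl.1, hl.2, hδ.1]
  have hc : ∀ x, 0 ≤ l * (1 - l) * (ν x / μ x - 1) ^ 2 := fun x =>
    mul_nonneg (mul_nonneg hl.1.le h1l.le) (sq_nonneg _)
  rw [fDiv_leCam, chiSq, mul_sum, mul_sum]
  constructor <;> refine sum_le_sum fun x _ => ?_ <;>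
    rw [mul_left_comm, leCam, div_mul_eq_mul_div] <;>
    refine mul_le_mul_of_nonneg_left ?_ (hμ.1 x).le
  · exact div_le_div_of_nonneg_left (hc x) (h1δ.trans_le (hb x).1) (hb x).2
  · exact div_le_div_of_nonneg_left (hc x) h1δ (hb x).1

lemma integrableOn_weight (Υ : MeasureTheory.Measure ℝ) [MeasureTheory.IsFiniteMeasure Υ] :
    MeasureTheory.IntegrableOn (fun l : ℝ => l * (l * (1 - l))) (Set.Ioo (0 : ℝ) 1) Υ := by
  refine MeasureTheory.Measure.integrableOn_of_bounded (M := 1)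
    (MeasureTheory.measure_ne_top _ _)
    (by fun_prop : Measurable fun l : ℝ => l * (l * (1 - l))).aestronglyMeasurable ?_
  filter_upwards [MeasureTheory.ae_restrict_mem measurableSet_Ioo] with l hl
  have h1l : 0 < 1 - l := by linarith [hl.2]
  rw [Real.norm_of_nonneg (by have := hl.1; positivity)]
  exact mul_le_one₀ hl.2.le (mul_nonneg hl.1.le h1l.le)
    (mul_le_one₀ hl.2.le h1l.le (by linarith [hl.1]))

lemma weight_integral_pos (Υ : MeasureTheory.Measure ℝ) [MeasureTheory.IsFiniteMeasure Υ]
    (h : 0 < Υ (Set.Ioo (0 : ℝ) 1)) :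
    0 < ∫ l in Set.Ioo (0 : ℝ) 1, l * (l * (1 - l)) ∂Υ := by
  have hpos : ∀ l ∈ Set.Ioo (0 : ℝ) 1, 0 < l * (l * (1 - l)) := fun l hl =>
    mul_pos hl.1 (mul_pos hl.1 (by linarith [hl.2]))
  rw [MeasureTheory.setIntegral_pos_iff_support_of_nonneg_ae
    (MeasureTheory.ae_restrict_of_forall_mem measurableSet_Ioo fun l hl => (hpos l hl).le)
    (integrableOn_weight Υ)]
  refine h.trans_le (MeasureTheory.measure_mono fun l hl => ⟨(hpos l hl).ne', hl⟩)

lemma fDiv_bounds {Φ : ℝ → ℝ} {β a b : ℝ} (hβ : 0 ≤ β) (Υ : MeasureTheory.Measure ℝ)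
    [MeasureTheory.IsFiniteMeasure Υ]
    (hrep : ∀ u : ℝ, 0 ≤ u →
      Φ u = β * u ^ 2 - (∫ l in Set.Ioo (0 : ℝ) 1, l * u / (l * u + 1 - l) ∂Υ) + a * u + b)
    {δ : ℝ} (hδ : δ ∈ Set.Ioo (0 : ℝ) 1) {ν μ : X → ℝ} (hν : IsDist ν) (hμ : IsPosDist μ)
    (hνμ : ∀ x, |ν x / μ x - 1| ≤ δ) :
    (β + ∫ l in Set.Ioo (0 : ℝ) 1, l * (l * (1 - l)) ∂Υ) * chiSq ν μ / (1 + δ) ≤ fDiv Φ ν μ ∧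
      fDiv Φ ν μ ≤
        (β + ∫ l in Set.Ioo (0 : ℝ) 1, l * (l * (1 - l)) ∂Υ) * chiSq ν μ / (1 - δ) := by
  have h1δ : 0 < 1 - δ := by linarith [hδ.2]
  have h1δ' : 0 < 1 + δ := by linarith [hδ.1]
  have hχ : 0 ≤ β * chiSq ν μ := mul_nonneg hβ (chiSq_nonneg hμ)
  have hmix := fDiv_eq_mixture Υ hrep hν hμ
  have hint := integrableOn_mul_fDiv_leCam Υ hν hμ
  have hw := fun c : ℝ => (integrableOn_weight Υ).mul_const c
  have hlo := MeasureTheory.setIntegral_mono_on (hw (chiSq ν μ / (1 + δ))) hint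
    measurableSet_Ioo fun l hl => by
      have := mul_le_mul_of_nonneg_left (fDiv_leCam_bounds hl hδ hμ hνμ).1 hl.1.le
      exact (le_of_eq (by ring)).trans this
  have hhi := MeasureTheory.setIntegral_mono_on hint (hw (chiSq ν μ / (1 - δ)))
    measurableSet_Ioo fun l hl => by
      have := mul_le_mul_of_nonneg_left (fDiv_leCam_bounds hl hδ hμ hνμ).2 hl.1.le
      exact this.trans (le_of_eq (by ring))
  rw [MeasureTheory.integral_mul_const] at hlo hhi
  have h1 : β * chiSq ν μ / (1 + δ) ≤ β * chiSq ν μ := div_le_self hχ (by linarith [hδ.1])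
  have h2 : β * chiSq ν μ ≤ β * chiSq ν μ / (1 - δ) := le_div_self hχ h1δ (by linarith [hδ.1])
  rw [hmix, add_mul, add_div, add_div, mul_div_assoc _ _ (1 + δ), mul_div_assoc _ _ (1 - δ)]
  rw [mul_div_assoc] at h1 h2
  constructor
  · rw [mul_div_assoc]; linarith
  · rw [mul_div_assoc]; linarith

lemma fDiv_nonneg_of_mixture {Φ : ℝ → ℝ} {β a b : ℝ} (hβ : 0 ≤ β)
    (Υ : MeasureTheory.Measure ℝ) [MeasureTheory.IsFiniteMeasure Υ]
    (hrep : ∀ u : ℝ, 0 ≤ u →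
      Φ u = β * u ^ 2 - (∫ l in Set.Ioo (0 : ℝ) 1, l * u / (l * u + 1 - l) ∂Υ) + a * u + b)
    {ν μ : X → ℝ} (hν : IsDist ν) (hμ : IsPosDist μ) : 0 ≤ fDiv Φ ν μ := by
  rw [fDiv_eq_mixture Υ hrep hν hμ]
  exact add_nonneg (mul_nonneg hβ (chiSq_nonneg hμ))
    (MeasureTheory.setIntegral_nonneg measurableSet_Ioo fun l hl =>
      mul_nonneg hl.1.le (fDiv_leCam_nonneg hl hν hμ))

lemma fDiv_ratio_le {Φ : ℝ → ℝ} {β a b : ℝ} (hβ : 0 ≤ β)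
    (Υ : MeasureTheory.Measure ℝ) [MeasureTheory.IsFiniteMeasure Υ]
    (hrep : ∀ u : ℝ, 0 ≤ u →
      Φ u = β * u ^ 2 - (∫ l in Set.Ioo (0 : ℝ) 1, l * u / (l * u + 1 - l) ∂Υ) + a * u + b)
    {ν μ : X → ℝ} {K : X → Y → ℝ} (hν : IsDist ν) (hμ : IsPosDist μ) (hK : IsChannel K)
    (hadm : ∀ y, 0 < push μ K y) {M : ℝ} (hS : maxCorr μ K ^ 2 ≤ M)
    (hL : ∀ l ∈ Set.Ioo (0 : ℝ) 1, eta (leCam l) μ K ≤ M) :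
    fDiv Φ (push ν K) (push μ K) / fDiv Φ ν μ ≤ M := by
  have hπ : IsPosDist (push μ K) := ⟨hadm, (push_isDist hμ.isDist hK).2⟩
  have hνK := push_isDist hν hK
  refine div_le_of_le_mul₀ (fDiv_nonneg_of_mixture hβ Υ hrep hν hμ) ((sq_nonneg _).trans hS) ?_
  rw [fDiv_eq_mixture Υ hrep hν hμ, fDiv_eq_mixture Υ hrep hνK hπ, mul_add,
    ← MeasureTheory.integral_const_mul]
  refine add_le_add ?_ ?_
  · rw [mul_left_comm]
    exact mul_le_mul_of_nonneg_left ((chiSq_push_le hν hμ hK hadm).trans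
      (mul_le_mul_of_nonneg_right hS (chiSq_nonneg hμ))) hβ
  · refine MeasureTheory.setIntegral_mono_on (integrableOn_mul_fDiv_leCam Υ hνK hπ)
      ((integrableOn_mul_fDiv_leCam Υ hν hμ).const_mul M) measurableSet_Ioo fun l hl => ?_
    rw [mul_left_comm]
    exact mul_le_mul_of_nonneg_left ((fDiv_leCam_push_le_eta_mul hl hν hμ hK hadm).trans
      (mul_le_mul_of_nonneg_right (hL l hl) (fDiv_leCam_nonneg hl hν hμ))) hl.1.le

lemma condExp_const_mul {Y : Type} (μ : X → ℝ) (K : X → Y → ℝ) (c : ℝ) (f : X → ℝ) (y : Y) :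
    condExp μ K (fun x => c * f x) y = c * condExp μ K f y := by
  rw [condExp, condExp, mul_div_assoc', mul_sum]
  congr 1
  exact sum_congr rfl fun x _ => by ring

lemma abs_condExp_le {μ : X → ℝ} {K : X → Y → ℝ} (hμ : IsPosDist μ) (hK : IsChannel K)
    (hadm : ∀ y, 0 < push μ K y) {f : X → ℝ} {c : ℝ} (hf : ∀ x, |f x| ≤ c) (y : Y) :
    |condExp μ K f y| ≤ c := by
  rw [condExp, abs_div, abs_of_pos (hadm y), div_le_iff₀ (hadm y), push, mul_sum]
  refine (abs_sum_le_sum_abs _ _).trans (sum_le_sum fun x _ => ?_)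
  have h := mul_nonneg (hμ.1 x).le (hK.1 x y)
  rw [abs_mul, abs_of_nonneg h, mul_comm c]
  exact mul_le_mul_of_nonneg_left (hf x) h

/-- Second-order perturbation of `μ` bounds the contraction constant from below. -/
lemma sum_condExp_sq_le_of_ratio_le {Φ : ℝ → ℝ} {β a b : ℝ} (hβ : 0 ≤ β)
    (Υ : MeasureTheory.Measure ℝ) [MeasureTheory.IsFiniteMeasure Υ]
    (hrep : ∀ u : ℝ, 0 ≤ u →
      Φ u = β * u ^ 2 - (∫ l in Set.Ioo (0 : ℝ) 1, l * u / (l * u + 1 - l) ∂Υ) + a * u + b)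
    (hC : 0 < β + ∫ l in Set.Ioo (0 : ℝ) 1, l * (l * (1 - l)) ∂Υ)
    {μ : X → ℝ} {K : X → Y → ℝ} (hμ : IsPosDist μ) (hK : IsChannel K)
    (hadm : ∀ y, 0 < push μ K y) {M : ℝ}
    (hM : ∀ ν, IsDist ν → ν ≠ μ → fDiv Φ (push ν K) (push μ K) / fDiv Φ ν μ ≤ M)
    {f : X → ℝ} (hf : ∑ x, μ x * f x = 0) (hf2 : ∑ x, μ x * f x ^ 2 = 1) :
    ∑ y, push μ K y * condExp μ K f y ^ 2 ≤ M := by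
  have hπ : IsPosDist (push μ K) := ⟨hadm, (push_isDist hμ.isDist hK).2⟩
  set W := ∑ y, push μ K y * condExp μ K f y ^ 2 with hW
  set C := β + ∫ l in Set.Ioo (0 : ℝ) 1, l * (l * (1 - l)) ∂Υ with hCdef
  obtain ⟨B, hB0, hB⟩ : ∃ B : ℝ, 0 < B ∧ ∀ x, |f x| ≤ B :=
    ⟨∑ x, |f x| + 1, add_pos_of_nonneg_of_pos (sum_nonneg fun _ _ => abs_nonneg _) one_pos,
      fun x => (single_le_sum (fun x _ => abs_nonneg (f x)) (mem_univ x)).trans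
        (le_add_of_nonneg_right zero_le_one)⟩
  have key : ∀ δ ∈ Set.Ioo (0 : ℝ) 1, W * ((1 - δ) / (1 + δ)) ≤ M := by
    intro δ hδ
    have h1δ : 0 < 1 - δ := by linarith [hδ.2]
    have h1δ' : 0 < 1 + δ := by linarith [hδ.1]
    set ε := δ / B with hε
    have hεpos : 0 < ε := div_pos hδ.1 hB0
    have hεf : ∀ x, |ε * f x| ≤ δ := fun x => by
      rw [abs_mul, abs_of_pos hεpos]
      exact (mul_le_mul_of_nonneg_left (hB x) hεpos.le).trans_eq (div_mul_cancel₀ _ hB0.ne')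
    have hratio : ∀ x, μ x * (1 + ε * f x) / μ x - 1 = ε * f x := fun x => by
      rw [mul_div_cancel_left₀ _ (hμ.1 x).ne']; ring
    have hν : IsDist fun x => μ x * (1 + ε * f x) := by
      refine ⟨fun x => mul_nonneg (hμ.1 x).le (by linarith [(abs_le.1 (hεf x)).1]), ?_⟩
      have : ∀ x, μ x * (1 + ε * f x) = μ x + ε * (μ x * f x) := fun x => by ring
      rw [sum_congr rfl fun x _ => this x, sum_add_distrib, ← mul_sum, hf, hμ.2]
      ring
    have hne : (fun x => μ x * (1 + ε * f x)) ≠ μ := by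
      intro h
      have hz : ∀ x, f x = 0 := fun x => by
        have hx := hratio x
        rw [show μ x * (1 + ε * f x) = μ x from congrFun h x, div_self (hμ.1 x).ne', sub_self]
          at hx
        exact (mul_eq_zero.1 hx.symm).resolve_left hεpos.ne'
      simp [hz] at hf2
    have hχ : chiSq (fun x => μ x * (1 + ε * f x)) μ = ε ^ 2 := by
      simp only [chiSq, hratio, mul_pow, mul_left_comm _ (ε ^ 2), ← mul_sum, hf2, mul_one]
    have hpush : ∀ y, push (fun x => μ x * (1 + ε * f x)) K y / push μ K y - 1 =
        ε * condExp μ K f y := fun y => by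
      rw [push_div_sub_one hμ hadm]
      simp only [hratio]
      exact condExp_const_mul μ K ε f y
    have hχK : chiSq (push (fun x => μ x * (1 + ε * f x)) K) (push μ K) = ε ^ 2 * W := by
      simp only [chiSq, hpush, mul_pow, mul_left_comm _ (ε ^ 2), ← mul_sum, hW]
    have hlo := (fDiv_bounds hβ Υ hrep hδ (push_isDist hν hK) hπ fun y => by
      rw [hpush y, ← condExp_const_mul]
      exact abs_condExp_le hμ hK hadm hεf y).1
    have hbd := fDiv_bounds hβ Υ hrep hδ hν hμ fun x => by rw [hratio x]; exact hεf x
    rw [hχK] at hlo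
    rw [hχ] at hbd
    have hD : 0 < fDiv Φ (fun x => μ x * (1 + ε * f x)) μ :=
      lt_of_lt_of_le (by positivity) hbd.1
    have hW0 : 0 ≤ W := sum_nonneg fun y _ => mul_nonneg (hadm y).le (sq_nonneg _)
    refine le_trans ?_ (hM _ hν hne)
    rw [le_div_iff₀ hD]
    refine (mul_le_mul_of_nonneg_left hbd.2 (by positivity)).trans (le_trans (le_of_eq ?_) hlo)
    field_simp
  have hlim : Filter.Tendsto (fun δ : ℝ => W * ((1 - δ) / (1 + δ)))
      (nhdsWithin 0 (Set.Ioi 0)) (nhds W) := by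
    have : ContinuousAt (fun δ : ℝ => W * ((1 - δ) / (1 + δ))) 0 := by
      refine continuousAt_const.mul (ContinuousAt.div ?_ ?_ (by norm_num)) <;> fun_prop
    simpa using this.tendsto.mono_left (nhdsWithin_le_nhds (s := Set.Ioi 0))
  exact le_of_tendsto hlim
    (Filter.mem_of_superset (Ioo_mem_nhdsGT zero_lt_one) key)

lemma maxCorr_nonneg (μ : X → ℝ) (K : X → Y → ℝ) (hμ : IsPosDist μ) (hK : IsChannel K) :
    0 ≤ maxCorr μ K := by
  rcases Set.eq_empty_or_nonempty { r | ∃ (f : X → ℝ) (g : Y → ℝ),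
    (∑ x, μ x * f x) = 0 ∧ (∑ y, push μ K y * g y) = 0 ∧
    (∑ x, μ x * (f x) ^ 2) = 1 ∧ (∑ y, push μ K y * (g y) ^ 2) = 1 ∧
    r = ∑ x, ∑ y, μ x * K x y * (f x * g y) } with h | ⟨r, f, g, h1, h2, h3, h4, hr⟩
  · rw [maxCorr, h, Real.sSup_empty]
  have hbdd : ∀ g' : Y → ℝ, ∑ y, push μ K y * g' y = 0 → ∑ y, push μ K y * g' y ^ 2 = 1 →
      ∑ x, ∑ y, μ x * K x y * (f x * g' y) ≤ maxCorr μ K := fun g' h2' h4' => by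
    refine le_csSup ⟨1, ?_⟩ ⟨f, g', h1, h2', h3, h4', rfl⟩
    rintro _ ⟨f', g', -, -, h1, h2, rfl⟩
    exact joint_sum_le_one hμ hK h1 h2
  have hp := hbdd g h2 h4
  have hn := hbdd (fun y => -g y) (by simp [h2]) (by simp [h4])
  simp only [mul_neg, sum_neg_distrib] at hn
  linarith

lemma joint_sum_sq_le {μ : X → ℝ} {K : X → Y → ℝ} (hadm : ∀ y, 0 < push μ K y) (f : X → ℝ)
    {g : Y → ℝ} (hg : ∑ y, push μ K y * g y ^ 2 = 1) :
    (∑ x, ∑ y, μ x * K x y * (f x * g y)) ^ 2 ≤ ∑ y, push μ K y * condExp μ K f y ^ 2 := by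
  have := sum_sq_le_sum_mul_sum_of_sq_le_mul univ
    (r := fun y => push μ K y * (condExp μ K f y * g y))
    (f := fun y => push μ K y * condExp μ K f y ^ 2) (g := fun y => push μ K y * g y ^ 2)
    (fun y _ => mul_nonneg (hadm y).le (sq_nonneg _))
    (fun y _ => mul_nonneg (hadm y).le (sq_nonneg _)) (fun y _ => le_of_eq (by ring))
  rwa [hg, mul_one, ← joint_sum_eq hadm] at this

/-- Theorem: if convex `Φ` admits the Loewner-type representation
`Φ(u) = βu² − ∫_{(0,1)} λu/(λu+1−λ) Υ(dλ) + au + b` with `β ≥ 0` and `Υ` a finite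
positive measure on `(0,1)`, then for every admissible pair `(μ,K)`,
`η_Φ(μ,K) ≤ max(S(μ,K)², sup_{0<λ<1} η_{LC_λ}(μ,K))`; and if moreover `β > 0` or
`Υ((0,1)) > 0`, then also `η_Φ(μ,K) ≥ S(μ,K)²`. -/
theorem statement4 {X Y : Type} [Fintype X] [Fintype Y] [Nonempty X] [Nonempty Y]
    (Φ : ℝ → ℝ) (hconv : ConvexOn ℝ (Set.Ici 0) Φ)
    (β a b : ℝ) (hβ : 0 ≤ β)
    (Υ : MeasureTheory.Measure ℝ) [MeasureTheory.IsFiniteMeasure Υ]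
    (hsupp : Υ (Set.Ioo (0:ℝ) 1)ᶜ = 0)
    (hrep : ∀ u : ℝ, 0 ≤ u →
      Φ u = β * u ^ 2 - (∫ l in Set.Ioo (0:ℝ) 1, l * u / (l * u + 1 - l) ∂Υ)
        + a * u + b)
    (μ : X → ℝ) (K : X → Y → ℝ) (hμ : IsPosDist μ) (hK : IsChannel K)
    (hadm : ∀ y, 0 < push μ K y) :
    eta Φ μ K ≤
      max ((maxCorr μ K) ^ 2)
        (sSup { r | ∃ l : ℝ, l ∈ Set.Ioo (0:ℝ) 1 ∧
          r = eta (fun u => l * (1 - l) * (u - 1) ^ 2 / (l * u + 1 - l)) μ K }) ∧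
    ((0 < β ∨ 0 < Υ (Set.Ioo (0:ℝ) 1)) → (maxCorr μ K) ^ 2 ≤ eta Φ μ K) := by
  set L := sSup { r | ∃ l : ℝ, l ∈ Set.Ioo (0:ℝ) 1 ∧
    r = eta (fun u => l * (1 - l) * (u - 1) ^ 2 / (l * u + 1 - l)) μ K } with hLdef
  have hL : ∀ l ∈ Set.Ioo (0:ℝ) 1, eta (leCam l) μ K ≤ max (maxCorr μ K ^ 2) L := by
    intro l hl
    refine le_max_of_le_right (le_csSup ⟨1, ?_⟩ ⟨l, hl, rfl⟩)
    rintro _ ⟨l', hl', rfl⟩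
    exact eta_leCam_le_one hl' hμ hK hadm
  have hM : ∀ ν, IsDist ν → ν ≠ μ →
      fDiv Φ (push ν K) (push μ K) / fDiv Φ ν μ ≤ max (maxCorr μ K ^ 2) L :=
    fun ν hν _ => fDiv_ratio_le hβ Υ hrep hν hμ hK hadm (le_max_left _ _) hL
  constructor
  · refine Real.sSup_le ?_ (le_max_of_le_left (sq_nonneg _))
    rintro _ ⟨ν, hν, hne, rfl⟩
    exact hM ν hν hne
  intro hpos
  have hw0 : 0 ≤ ∫ l in Set.Ioo (0:ℝ) 1, l * (l * (1 - l)) ∂Υ :=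
    MeasureTheory.setIntegral_nonneg measurableSet_Ioo fun l hl =>
      mul_nonneg hl.1.le (mul_nonneg hl.1.le (by linarith [hl.2]))
  have hC : 0 < β + ∫ l in Set.Ioo (0:ℝ) 1, l * (l * (1 - l)) ∂Υ := by
    rcases hpos with h | h
    · linarith
    · linarith [weight_integral_pos Υ h]
  have hη : ∀ ν, IsDist ν → ν ≠ μ →
      fDiv Φ (push ν K) (push μ K) / fDiv Φ ν μ ≤ eta Φ μ K := fun ν hν hne =>
    le_csSup ⟨_, by rintro _ ⟨ν', hν', hne', rfl⟩; exact hM ν' hν' hne'⟩ ⟨ν, hν, hne, rfl⟩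
  have hη0 : 0 ≤ eta Φ μ K := by
    refine Real.sSup_nonneg ?_
    rintro _ ⟨ν, hν, -, rfl⟩
    exact div_nonneg (fDiv_nonneg_of_mixture hβ Υ hrep (push_isDist hν hK)
      ⟨hadm, (push_isDist hμ.isDist hK).2⟩) (fDiv_nonneg_of_mixture hβ Υ hrep hν hμ)
  have hS : maxCorr μ K ≤ √(eta Φ μ K) := by
    refine Real.sSup_le ?_ (Real.sqrt_nonneg _)
    rintro _ ⟨f, g, hf, -, hf2, hg2, rfl⟩
    exact Real.le_sqrt_of_sq_le ((joint_sum_sq_le hadm f hg2).trans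
      (sum_condExp_sq_le_of_ratio_le hβ Υ hrep hC hμ hK hadm hη hf hf2))
  exact (Real.le_sqrt (maxCorr_nonneg μ K hμ hK) hη0).1 hS

end SDPI
end
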